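/- In the heterogeneous setup with λ > 0, let d_min be the minimum diagonal entry of D_blk and let σ_max ≥ 0 be the largest eigenvalue of the symmetric matrix Q − P. Let (Y^{(k)})_{k≥0} be the preconditioned gradient iterates defined from any initialization Y^{(0)} by Y_s^{(k+1)} = Y_s^{(k)} − α (I + λ D_s)^{-1} ∇_{Y_s} ℓ(Y^{(k)}) for each s ∈ S. If 0 < α < (2 + 2λ d_min) / (1 + λ (d_min + σ_max)), then the iterates monotonically decrease the energy, i.e. ℓ(Y^{(k+1)}) ≤ ℓ(Y^{(k)}) for all k, and Y^{(k)} converges as k → ∞ to the unique global minimizer of ℓ. (Theorem 3.2) -/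

import Mathlib

open Matrix Kronecker BigOperators

/-- **Heterogeneous setup.**  `S` is a finite set of node types; each `s : S` has `n s`
nodes and feature dimension `d s ≥ 1`.  For each ordered pair of node types `(s, s')`,
`T s s'` is the (finite) set of edge types connecting them; each `t : T s s'` carries a
0/1 adjacency matrix `A t ∈ ℝ^{n s × n s'}` and a compatibility matrix
`H t ∈ ℝ^{d s × d s'}`.  The edge types are closed under inversion: `einv t : T s' s`
satisfies `einv (einv t) = t` and `A (einv t) = (A t)ᵀ`. -/
structure HeteroSetup where
  S : Type
  [fintypeS : Fintype S]
  [decEqS : DecidableEq S]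
  n : S → ℕ
  d : S → ℕ
  d_pos : ∀ s, 1 ≤ d s
  T : S → S → Type
  [fintypeT : ∀ s s', Fintype (T s s')]
  A : ∀ {s s' : S}, T s s' → Matrix (Fin (n s)) (Fin (n s')) ℝ
  H : ∀ {s s' : S}, T s s' → Matrix (Fin (d s)) (Fin (d s')) ℝ
  einv : ∀ {s s' : S}, T s s' → T s' s
  einv_einv : ∀ {s s' : S} (t : T s s'), einv (einv t) = t
  A_einv : ∀ {s s' : S} (t : T s s'), A (einv t) = (A t)ᵀ
  A_zero_one : ∀ {s s' : S} (t : T s s') (i : Fin (n s)) (j : Fin (n s')),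
    A t i j = 0 ∨ A t i j = 1

attribute [instance] HeteroSetup.fintypeS HeteroSetup.decEqS HeteroSetup.fintypeT

namespace HeteroSetup

variable (hg : HeteroSetup)

/-- The space of node embeddings `Y = (Y_s)_{s ∈ S}`, `Y_s ∈ ℝ^{n_s × d_s}`. -/
abbrev Emb := ∀ s : hg.S, Matrix (Fin (hg.n s)) (Fin (hg.d s)) ℝ

/-- The type-`t` degree matrix `D_{st}` of type-`s` nodes: the diagonal matrix of the
row sums of `A t` for `t ∈ T_{ss'}`. -/
noncomputable def Dst {s s' : hg.S} (t : hg.T s s') : Matrix (Fin (hg.n s)) (Fin (hg.n s)) ℝ :=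
  Matrix.diagonal fun i => ∑ j, hg.A t i j

/-- `D_s = Σ_{s'∈S} Σ_{t∈T_{ss'}} D_{st}`. -/
noncomputable def Dtot (s : hg.S) : Matrix (Fin (hg.n s)) (Fin (hg.n s)) ℝ :=
  ∑ s' : hg.S, ∑ t : hg.T s s', hg.Dst t

/-- The heterogeneous energy
`ℓ(Y) = Σ_s [ (1/2)‖Y_s − B_s‖_F² + (λ/2) Σ_{s'} Σ_{t ∈ T_{ss'}} Σ_{(i,j) : (A_t)_{ij} = 1}
‖(Y_s)_{i,:} H_t − (Y_{s'})_{j,:}‖² ]`.  Since the entries of `A t` are 0 or 1, the sum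
over the edges `(i,j)` with `(A_t)_{ij} = 1` is written with the weight `A t i j`. -/
noncomputable def energy (lam : ℝ) (B : hg.Emb) (Y : hg.Emb) : ℝ :=
  ∑ s : hg.S,
    ((1 / 2 : ℝ) * ∑ i, ∑ k, (Y s i k - B s i k) ^ 2 +
      lam / 2 * ∑ s' : hg.S, ∑ t : hg.T s s', ∑ i, ∑ j,
        hg.A t i j * ∑ k', ((Y s i ᵥ* hg.H t) k' - Y s' j k') ^ 2)

/-- The global index set for the stacked column-vectorization `vec(Y)`: node type `s`,
column (feature) index `k : Fin (d s)`, row (node) index `i : Fin (n s)`. -/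
abbrev Idx := Σ s : hg.S, Fin (hg.d s) × Fin (hg.n s)

/-- The stacked column-vectorization `vec(Y)`, concatenating `vec(Y_s)` over `s ∈ S`:
`vec(Y)⟨s, (k, i)⟩ = (Y_s)_{ik}`. -/
noncomputable def vecOf (Y : hg.Emb) : hg.Idx → ℝ := fun x => Y x.1 x.2.2 x.2.1

/-- The block matrix `P` with blocks `P_{ss'} = Σ_{t∈T_{ss'}} (H_t + H_{t_inv}ᵀ) ⊗ A_t`
(entrywise: the `((k,i),(k',j))` entry of the `(s,s')` block is
`(H_t + H_{t_inv}ᵀ)_{k k'} (A_t)_{i j}`). -/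
noncomputable def Pmat : Matrix hg.Idx hg.Idx ℝ := fun x y =>
  ∑ t : hg.T x.1 y.1, (hg.H t + (hg.H (hg.einv t))ᵀ) x.2.1 y.2.1 * hg.A t x.2.2 y.2.2

/-- The block-diagonal matrix `Q` with diagonal blocks
`Q_s = Σ_{s'∈S} Σ_{t∈T_{ss'}} (H_t H_tᵀ ⊗ D_{st})`. -/
noncomputable def Qmat : Matrix hg.Idx hg.Idx ℝ :=
  Matrix.blockDiagonal' fun s => ∑ s' : hg.S, ∑ t : hg.T s s',
    (hg.H t * (hg.H t)ᵀ) ⊗ₖ hg.Dst t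

/-- The block-diagonal matrix `D_blk` with diagonal blocks `I_{d_s} ⊗ D_s`. -/
noncomputable def Dblk : Matrix hg.Idx hg.Idx ℝ :=
  Matrix.blockDiagonal' fun s => (1 : Matrix (Fin (hg.d s)) (Fin (hg.d s)) ℝ) ⊗ₖ hg.Dtot s

end HeteroSetup

open Matrix HeteroSetup Filter

namespace HeteroSetup

/-- The gradient `∇_{Y_s} ℓ(Y)` of the heterogeneous energy with respect to `Y_s`
(Lemma 3.1 / equation (12) of the paper):
`∇_{Y_s} ℓ(Y) = (I + λ D_s) Y_s − B_s
  + λ Σ_{s'∈S} Σ_{t∈T_{ss'}} ( D_{st} Y_s (H_t H_tᵀ) − A_t Y_{s'} (H_tᵀ + H_{t_inv}) )`. -/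
noncomputable def energyGrad (hg : HeteroSetup) (lam : ℝ) (B : hg.Emb) (Y : hg.Emb)
    (s : hg.S) : Matrix (Fin (hg.n s)) (Fin (hg.d s)) ℝ :=
  (1 + lam • hg.Dtot s) * Y s - B s +
    lam • ∑ s' : hg.S, ∑ t : hg.T s s',
      (hg.Dst t * Y s * (hg.H t * (hg.H t)ᵀ) -
        hg.A t * Y s' * ((hg.H t)ᵀ + hg.H (hg.einv t)))

end HeteroSetup

section QuadraticDescent

variable {ι : Type*} [Fintype ι]

theorem Matrix.IsSymm.dotProduct_mulVec_comm {K : Matrix ι ι ℝ} (hK : K.IsSymm) (x y : ι → ℝ) :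
    x ⬝ᵥ K *ᵥ y = y ⬝ᵥ K *ᵥ x := by
  rw [dotProduct_mulVec, ← mulVec_transpose, hK.eq, dotProduct_comm]

/-- The Rayleigh quotient of a real symmetric matrix is bounded by any bound on its eigenvalues. -/
theorem Matrix.IsSymm.dotProduct_mulVec_le [DecidableEq ι] {A : Matrix ι ι ℝ} (hA : A.IsSymm)
    {σ : ℝ} (hσ : ∀ μ : ℝ, (∃ v : ι → ℝ, v ≠ 0 ∧ A *ᵥ v = μ • v) → μ ≤ σ) (x : ι → ℝ) :
    x ⬝ᵥ A *ᵥ x ≤ σ * (x ⬝ᵥ x) := by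
  have hH : (σ • (1 : Matrix ι ι ℝ) - A).IsHermitian := by
    rw [IsHermitian, conjTranspose_eq_transpose_of_trivial, transpose_sub, transpose_smul,
      transpose_one, hA.eq]
  have hpsd : (σ • (1 : Matrix ι ι ℝ) - A).PosSemidef := by
    rw [hH.posSemidef_iff_eigenvalues_nonneg]
    intro i
    have hv := hH.mulVec_eigenvectorBasis i
    have hne : (⇑(hH.eigenvectorBasis i) : ι → ℝ) ≠ 0 := fun h =>
      hH.eigenvectorBasis.toBasis.ne_zero i (by ext j; simpa using congrFun h j)
    rw [sub_mulVec, smul_mulVec, one_mulVec] at hv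
    have := hσ (σ - hH.eigenvalues i) ⟨_, hne, by rw [sub_smul, ← hv, sub_sub_cancel]⟩
    simpa using this
  have h := hpsd.dotProduct_mulVec_nonneg x
  simp only [star_trivial, sub_mulVec, smul_mulVec, one_mulVec, dotProduct_sub, dotProduct_smul,
    smul_eq_mul] at h
  linarith

theorem quadratic_add {K : Matrix ι ι ℝ} (hK : K.IsSymm) (b x v : ι → ℝ) :
    1 / 2 * ((x + v) ⬝ᵥ K *ᵥ (x + v)) - b ⬝ᵥ (x + v) =
      1 / 2 * (x ⬝ᵥ K *ᵥ x) - b ⬝ᵥ x + v ⬝ᵥ (K *ᵥ x - b) + 1 / 2 * (v ⬝ᵥ K *ᵥ v) := by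
  simp only [mulVec_add, dotProduct_add, add_dotProduct, dotProduct_sub]
  rw [hK.dotProduct_mulVec_comm x v, dotProduct_comm b v]
  ring

/-- Descent of diagonally preconditioned gradient steps on a quadratic function. -/
theorem quadratic_precond_step_le {K : Matrix ι ι ℝ} (hK : K.IsSymm) (b : ι → ℝ) {m : ι → ℝ}
    (hm : ∀ i, 1 ≤ m i) {L α : ℝ}
    (hL : ∀ v, v ⬝ᵥ K *ᵥ v ≤ L * ∑ i, m i * v i ^ 2) (hα0 : 0 < α) (hα : α * L < 2)
    {x x' p : ι → ℝ} (hp : ∀ i, p i = (m i)⁻¹ * (K *ᵥ x - b) i) (hx' : x' = x - α • p) :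
    1 / 2 * (x' ⬝ᵥ K *ᵥ x') - b ⬝ᵥ x' + α * (1 - α * L / 2) * (p ⬝ᵥ p) ≤
      1 / 2 * (x ⬝ᵥ K *ᵥ x) - b ⬝ᵥ x := by
  have hg : p ⬝ᵥ (K *ᵥ x - b) = ∑ i, m i * p i ^ 2 := by
    refine Finset.sum_congr rfl fun i _ => ?_
    have : m i ≠ 0 := (zero_lt_one.trans_le (hm i)).ne'
    rw [show (K *ᵥ x - b) i = m i * p i by rw [hp i]; field_simp]
    ring
  have hpp : p ⬝ᵥ p ≤ ∑ i, m i * p i ^ 2 := by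
    refine Finset.sum_le_sum fun i _ => ?_
    nlinarith [hm i, sq_nonneg (p i)]
  have hq := quadratic_add hK b x (-(α • p))
  rw [← sub_eq_add_neg, ← hx'] at hq
  simp only [mulVec_neg, mulVec_smul, neg_dotProduct, dotProduct_neg, smul_dotProduct,
    dotProduct_smul, smul_eq_mul, hg] at hq
  have h1 : 0 < α * (1 - α * L / 2) := by apply mul_pos hα0; linarith
  have h2 := mul_le_mul_of_nonneg_left hpp h1.le
  have h3 := mul_le_mul_of_nonneg_left (hL p) (by positivity : 0 ≤ α * α / 2)
  rw [hq]
  nlinarith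

theorem tendsto_zero_of_dotProduct_self {p : ℕ → ι → ℝ}
    (h : Tendsto (fun k => p k ⬝ᵥ p k) atTop (nhds 0)) : Tendsto p atTop (nhds 0) := by
  rw [tendsto_pi_nhds]
  intro i
  rw [Pi.zero_apply, tendsto_zero_iff_abs_tendsto_zero]
  have hs : Tendsto (fun k => √(p k ⬝ᵥ p k)) atTop (nhds 0) := by
    simpa using h.sqrt
  refine squeeze_zero (fun _ => abs_nonneg _) (fun k => ?_) hs
  apply Real.le_sqrt_of_sq_le
  rw [Function.comp_apply, sq_abs, sq]
  exact Finset.single_le_sum (f := fun j => p k j * p k j) (fun j _ => mul_self_nonneg _)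
    (Finset.mem_univ i)

/-- A quadratic function whose Hessian dominates the identity has a unique minimizer, to which
diagonally preconditioned gradient descent with a small enough step converges. -/
theorem quadratic_precond_descent [DecidableEq ι] {K : Matrix ι ι ℝ} (hK : K.IsSymm)
    (hK1 : ∀ v, v ⬝ᵥ v ≤ v ⬝ᵥ K *ᵥ v) (b : ι → ℝ) {m : ι → ℝ} (hm : ∀ i, 1 ≤ m i) {L α : ℝ}
    (hL : ∀ v, v ⬝ᵥ K *ᵥ v ≤ L * ∑ i, m i * v i ^ 2) (hα0 : 0 < α) (hα : α * L < 2)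
    {x : ℕ → ι → ℝ} (hx : ∀ k i, x (k + 1) i = x k i - α * ((m i)⁻¹ * (K *ᵥ x k - b) i)) :
    ∃ c, (∀ z, 1 / 2 * (z ⬝ᵥ K *ᵥ z) - b ⬝ᵥ z =
        1 / 2 * (c ⬝ᵥ K *ᵥ c) - b ⬝ᵥ c + 1 / 2 * ((z - c) ⬝ᵥ K *ᵥ (z - c))) ∧
      Tendsto x atTop (nhds c) := by
  have hdet : IsUnit K.det := by
    rw [isUnit_iff_ne_zero]
    intro h
    obtain ⟨v, hv, hKv⟩ := exists_mulVec_eq_zero_iff.2 h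
    have := hK1 v
    rw [hKv, dotProduct_zero] at this
    exact hv (dotProduct_self_eq_zero.1 (le_antisymm this
      (Finset.sum_nonneg fun i _ => mul_self_nonneg (v i))))
  have hc : K *ᵥ (K⁻¹ *ᵥ b) = b := by rw [mulVec_mulVec, mul_nonsing_inv _ hdet, one_mulVec]
  have hmin : ∀ z, 1 / 2 * (z ⬝ᵥ K *ᵥ z) - b ⬝ᵥ z =
      1 / 2 * ((K⁻¹ *ᵥ b) ⬝ᵥ K *ᵥ (K⁻¹ *ᵥ b)) - b ⬝ᵥ (K⁻¹ *ᵥ b) +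
        1 / 2 * ((z - K⁻¹ *ᵥ b) ⬝ᵥ K *ᵥ (z - K⁻¹ *ᵥ b)) := by
    intro z
    have := quadratic_add hK b (K⁻¹ *ᵥ b) (z - K⁻¹ *ᵥ b)
    rw [add_sub_cancel, hc, sub_self, dotProduct_zero, add_zero] at this
    rw [hc, this]
  refine ⟨K⁻¹ *ᵥ b, hmin, ?_⟩
  set p : ℕ → ι → ℝ := fun k i => (m i)⁻¹ * (K *ᵥ x k - b) i with hp
  set f : (ι → ℝ) → ℝ := fun z => 1 / 2 * (z ⬝ᵥ K *ᵥ z) - b ⬝ᵥ z with hf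
  have hγ : 0 < α * (1 - α * L / 2) := by apply mul_pos hα0; linarith
  have hpp : ∀ k, 0 ≤ p k ⬝ᵥ p k := fun k => Finset.sum_nonneg fun i _ => mul_self_nonneg _
  have hstep : ∀ k, f (x (k + 1)) + α * (1 - α * L / 2) * (p k ⬝ᵥ p k) ≤ f (x k) := fun k =>
    quadratic_precond_step_le hK b hm hL hα0 hα (fun i => rfl) (funext fun i => hx k i)
  have hanti : Antitone fun k => f (x k) := antitone_nat_of_succ_le fun k => by
    have := mul_nonneg hγ.le (hpp k)
    linarith [hstep k]
  have hbdd : BddBelow (Set.range fun k => f (x k)) := by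
    refine ⟨f (K⁻¹ *ᵥ b), ?_⟩
    rintro _ ⟨k, rfl⟩
    have h1 := hK1 (x k - K⁻¹ *ᵥ b)
    have h2 : 0 ≤ (x k - K⁻¹ *ᵥ b) ⬝ᵥ (x k - K⁻¹ *ᵥ b) :=
      Finset.sum_nonneg fun i _ => mul_self_nonneg _
    have h3 := hmin (x k)
    simp only [hf]
    linarith
  have hlim := tendsto_atTop_ciInf hanti hbdd
  have hdiff : Tendsto (fun k => (α * (1 - α * L / 2))⁻¹ * (f (x k) - f (x (k + 1))))
      atTop (nhds 0) := by
    simpa using (hlim.sub (hlim.comp (tendsto_add_atTop_nat 1))).const_mul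
      (α * (1 - α * L / 2))⁻¹
  have hp0 : Tendsto p atTop (nhds 0) := by
    refine tendsto_zero_of_dotProduct_self (squeeze_zero hpp (fun k => ?_) hdiff)
    rw [inv_mul_eq_div, le_div_iff₀ hγ]
    linarith [hstep k]
  have hcont : Continuous fun q : ι → ℝ => K⁻¹ *ᵥ b + K⁻¹ *ᵥ (fun i => m i * q i) := by
    fun_prop
  have hlim' := (hcont.tendsto 0).comp hp0
  have hx_eq : ∀ k, x k = K⁻¹ *ᵥ b + K⁻¹ *ᵥ (fun i => m i * p k i) := by
    intro k
    have : (fun i => m i * p k i) = K *ᵥ x k - b := by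
      ext i
      have : m i ≠ 0 := (zero_lt_one.trans_le (hm i)).ne'
      simp only [hp]
      field_simp
    rw [this, mulVec_sub, mulVec_mulVec, nonsing_inv_mul _ hdet, one_mulVec, add_sub_cancel]
  refine (hlim'.congr fun k => (hx_eq k).symm).trans_eq ?_
  have : (fun i => m i * (0 : ι → ℝ) i) = 0 := by ext; simp
  rw [this, mulVec_zero, add_zero]

end QuadraticDescent

theorem Matrix.blockDiagonal'_mulVec_apply {ι : Type*} {κ : ι → Type*} [Fintype ι] [DecidableEq ι]
    [∀ i, Fintype (κ i)] (N : ∀ i, Matrix (κ i) (κ i) ℝ) (v : (Σ i, κ i) → ℝ) (x : Σ i, κ i) :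
    (blockDiagonal' N *ᵥ v) x = (N x.1 *ᵥ fun j => v ⟨x.1, j⟩) x.2 := by
  obtain ⟨i, x⟩ := x
  simp only [mulVec, dotProduct]
  rw [Fintype.sum_sigma, Finset.sum_eq_single i]
  · simp [blockDiagonal'_apply]
  · intro j _ hj
    simp [blockDiagonal'_apply, hj.symm]
  · simp

namespace HeteroSetup

variable (hg : HeteroSetup)

theorem sum_edgeType_eq_sum_einv (f : ∀ s s', hg.T s s' → ℝ) :
    ∑ s, ∑ s', ∑ t, f s s' t = ∑ s, ∑ s', ∑ t, f s' s (hg.einv t) := by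
  rw [Finset.sum_comm]
  refine Finset.sum_congr rfl fun s _ => Finset.sum_congr rfl fun s' _ => ?_
  exact (Equiv.sum_comp (⟨hg.einv, hg.einv, hg.einv_einv, hg.einv_einv⟩ : hg.T s s' ≃ hg.T s' s)
    (f s' s)).symm

theorem vecOf_dotProduct (X Z : hg.Emb) :
    hg.vecOf X ⬝ᵥ hg.vecOf Z = ∑ s, ∑ i, X s i ⬝ᵥ Z s i := by
  simp only [dotProduct, vecOf, Fintype.sum_sigma, Fintype.sum_prod_type]
  exact Finset.sum_congr rfl fun s _ => Finset.sum_comm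

theorem vecOf_surjective : Function.Surjective hg.vecOf :=
  fun v => ⟨fun s => of fun i k => v ⟨s, (k, i)⟩, rfl⟩

theorem Dblk_mulVec_vecOf (Y : hg.Emb) :
    hg.Dblk *ᵥ hg.vecOf Y = hg.vecOf fun s => hg.Dtot s * Y s := by
  ext ⟨s, x⟩
  rw [Dblk, blockDiagonal'_mulVec_apply]
  have := congrFun (kronecker_mulVec_vec (hg.Dtot s) (Y s) 1) x
  rw [transpose_one, Matrix.mul_one] at this
  exact this

theorem Qmat_mulVec_vecOf (Y : hg.Emb) :
    hg.Qmat *ᵥ hg.vecOf Y = hg.vecOf fun s => ∑ s', ∑ t : hg.T s s',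
      hg.Dst t * Y s * (hg.H t * (hg.H t)ᵀ) := by
  ext ⟨s, x⟩
  rw [Qmat, blockDiagonal'_mulVec_apply]
  have h : ∀ s' (t : hg.T s s'), _ := fun s' t =>
    congrFun (kronecker_mulVec_vec (hg.Dst t) (Y s) (hg.H t * (hg.H t)ᵀ)) x
  simp only [transpose_mul, transpose_transpose] at h
  simp only [sum_mulVec, Finset.sum_apply, vecOf, Matrix.sum_apply]
  exact Finset.sum_congr rfl fun s' _ => Finset.sum_congr rfl fun t _ => h s' t

theorem Pmat_mulVec_vecOf (Y : hg.Emb) :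
    hg.Pmat *ᵥ hg.vecOf Y = hg.vecOf fun s => ∑ s', ∑ t : hg.T s s',
      hg.A t * Y s' * ((hg.H t)ᵀ + hg.H (hg.einv t)) := by
  ext ⟨s, x⟩
  have h : ∀ s' (t : hg.T s s'), _ := fun s' t =>
    congrFun (kronecker_mulVec_vec (hg.A t) (Y s') (hg.H t + (hg.H (hg.einv t))ᵀ)) x
  simp only [transpose_add, transpose_transpose] at h
  simp only [vecOf, Matrix.sum_apply]
  rw [mulVec, dotProduct, Fintype.sum_sigma]
  refine Finset.sum_congr rfl fun s' _ => ?_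
  simp only [Pmat, Finset.sum_mul]
  calc
    _ = ∑ t : hg.T s s', ∑ y : Fin (hg.d s') × Fin (hg.n s'),
        (hg.H t + (hg.H (hg.einv t))ᵀ) x.1 y.1 * hg.A t x.2 y.2 * hg.vecOf Y ⟨s', y⟩ :=
      Finset.sum_comm
    _ = _ := Finset.sum_congr rfl fun t _ => h s' t

theorem Dtot_eq_diagonal (s : hg.S) :
    hg.Dtot s = diagonal fun i => ∑ s', ∑ t : hg.T s s', ∑ j, hg.A t i j := by
  ext i j
  simp only [Dtot, Dst, Matrix.sum_apply, diagonal_apply]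
  split_ifs <;> simp

theorem Dblk_eq_diagonal :
    hg.Dblk = diagonal fun x => ∑ s', ∑ t : hg.T x.1 s', ∑ j, hg.A t x.2.2 j := by
  ext ⟨s, k, i⟩ ⟨s', k', j⟩
  rw [Dblk, blockDiagonal'_apply, diagonal_apply]
  by_cases h : s = s'
  · subst h
    simp only [dite_true, cast_eq, kroneckerMap_apply, Dtot_eq_diagonal, diagonal_apply, one_apply,
      Sigma.mk.injEq, heq_eq_eq, true_and, Prod.mk.injEq]
    split_ifs <;> simp_all
  · simp [h]

theorem Dblk_apply_self_nonneg (x : hg.Idx) : 0 ≤ hg.Dblk x x := by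
  rw [Dblk_eq_diagonal, diagonal_apply_eq]
  refine Finset.sum_nonneg fun s' _ => Finset.sum_nonneg fun t _ => Finset.sum_nonneg fun j _ => ?_
  rcases hg.A_zero_one t x.2.2 j with h | h <;> simp [h]

theorem Qmat_isSymm : hg.Qmat.IsSymm := by
  rw [Matrix.IsSymm, Qmat, blockDiagonal'_transpose]
  congr 1
  ext1 s
  simp only [transpose_sum, ← kroneckerMap_transpose, transpose_mul, transpose_transpose, Dst,
    diagonal_transpose]

theorem Pmat_isSymm : hg.Pmat.IsSymm := by
  ext x y
  rw [transpose_apply, Pmat, Pmat]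
  refine Fintype.sum_equiv ⟨hg.einv, hg.einv, hg.einv_einv, hg.einv_einv⟩ _ _ fun t => ?_
  simp [hg.einv_einv, hg.A_einv, add_comm]

theorem Dblk_isSymm : hg.Dblk.IsSymm := by
  rw [Dblk_eq_diagonal]
  exact diagonal_transpose _

/-- The Hessian of the energy. -/
noncomputable def hessian (lam : ℝ) : Matrix hg.Idx hg.Idx ℝ :=
  1 + lam • (hg.Dblk + (hg.Qmat - hg.Pmat))

theorem hessian_isSymm (lam : ℝ) : (hg.hessian lam).IsSymm :=
  isSymm_one.add ((hg.Dblk_isSymm.add (hg.Qmat_isSymm.sub hg.Pmat_isSymm)).smul lam)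

theorem vecOf_energyGrad (lam : ℝ) (B Y : hg.Emb) :
    hg.vecOf (hg.energyGrad lam B Y) = hg.hessian lam *ᵥ hg.vecOf Y - hg.vecOf B := by
  rw [hessian, add_mulVec, one_mulVec, smul_mulVec, add_mulVec, sub_mulVec, Dblk_mulVec_vecOf,
    Qmat_mulVec_vecOf, Pmat_mulVec_vecOf]
  ext x
  simp only [vecOf, energyGrad, Matrix.add_mul, Matrix.one_mul, Matrix.smul_mul,
    Finset.sum_sub_distrib, Matrix.add_apply, Matrix.sub_apply, Matrix.smul_apply, Pi.add_apply,
    Pi.sub_apply, Pi.smul_apply, smul_eq_mul]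
  ring

section FrobeniusPairings

variable {m n p q : Type*} [Fintype m] [Fintype n] [Fintype p] [Fintype q]

theorem _root_.Matrix.sum_dotProduct_diagonal_mul [DecidableEq m] (δ : m → ℝ) (Y : Matrix m p ℝ)
    (H : Matrix p q ℝ) :
    ∑ i, Y i ⬝ᵥ (diagonal δ * Y * (H * Hᵀ)) i = ∑ i, δ i * ((Y i ᵥ* H) ⬝ᵥ (Y i ᵥ* H)) := by
  refine Finset.sum_congr rfl fun i _ => ?_
  have h : (diagonal δ * Y) i = δ i • Y i := by ext; simp [diagonal_mul]
  rw [mul_apply_eq_vecMul, h, ← vecMul_vecMul, vecMul_transpose, smul_vecMul, mulVec_smul,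
    dotProduct_smul, dotProduct_mulVec, smul_eq_mul]

theorem _root_.Matrix.sum_dotProduct_mul_mul (A : Matrix m n ℝ) (Y : Matrix m p ℝ)
    (Z : Matrix n q ℝ) (H : Matrix q p ℝ) :
    ∑ i, Y i ⬝ᵥ (A * Z * H) i = ∑ i, ∑ j, A i j * (Y i ⬝ᵥ (Z j ᵥ* H)) := by
  refine Finset.sum_congr rfl fun i _ => ?_
  rw [Matrix.mul_assoc, mul_apply_eq_vecMul, vecMul_eq_sum, dotProduct_sum]
  simp only [dotProduct_smul, smul_eq_mul, mul_apply_eq_vecMul]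

end FrobeniusPairings

theorem dotProduct_Qmat_mulVec (Y : hg.Emb) :
    hg.vecOf Y ⬝ᵥ hg.Qmat *ᵥ hg.vecOf Y = ∑ s, ∑ s', ∑ t : hg.T s s', ∑ i, ∑ j,
      hg.A t i j * ((Y s i ᵥ* hg.H t) ⬝ᵥ (Y s i ᵥ* hg.H t)) := by
  rw [Qmat_mulVec_vecOf, vecOf_dotProduct]
  refine Finset.sum_congr rfl fun s _ => ?_
  have h (i) : (∑ s', ∑ t : hg.T s s', hg.Dst t * Y s * (hg.H t * (hg.H t)ᵀ)) i =
      ∑ s', ∑ t : hg.T s s', (hg.Dst t * Y s * (hg.H t * (hg.H t)ᵀ)) i := by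
    ext; simp [Matrix.sum_apply]
  simp only [h, dotProduct_sum]
  rw [Finset.sum_comm]
  refine Finset.sum_congr rfl fun s' _ => ?_
  rw [Finset.sum_comm]
  refine Finset.sum_congr rfl fun t _ => ?_
  rw [Dst, sum_dotProduct_diagonal_mul]
  simp only [Finset.sum_mul]

theorem dotProduct_Dblk_mulVec (Y : hg.Emb) :
    hg.vecOf Y ⬝ᵥ hg.Dblk *ᵥ hg.vecOf Y = ∑ s, ∑ s', ∑ t : hg.T s s', ∑ i, ∑ j,
      hg.A t i j * (Y s' j ⬝ᵥ Y s' j) := by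
  rw [Dblk_mulVec_vecOf, vecOf_dotProduct, sum_edgeType_eq_sum_einv]
  refine Finset.sum_congr rfl fun s _ => ?_
  have h (i) : (hg.Dtot s * Y s) i = (∑ s', ∑ t : hg.T s s', ∑ j, hg.A t i j) • Y s i := by
    ext; simp [Dtot_eq_diagonal, diagonal_mul]
  simp only [h, dotProduct_smul, smul_eq_mul, Finset.sum_mul]
  rw [Finset.sum_comm]
  refine Finset.sum_congr rfl fun s' _ => ?_
  rw [Finset.sum_comm]
  refine Finset.sum_congr rfl fun t _ => ?_
  rw [Finset.sum_comm]
  simp only [hg.A_einv, transpose_apply]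

theorem dotProduct_Pmat_mulVec (Y : hg.Emb) :
    hg.vecOf Y ⬝ᵥ hg.Pmat *ᵥ hg.vecOf Y = ∑ s, ∑ s', ∑ t : hg.T s s', ∑ i, ∑ j,
      hg.A t i j * (2 * ((Y s i ᵥ* hg.H t) ⬝ᵥ Y s' j)) := by
  have hsplit : hg.vecOf Y ⬝ᵥ hg.Pmat *ᵥ hg.vecOf Y =
      (∑ s, ∑ s', ∑ t : hg.T s s', ∑ i, Y s i ⬝ᵥ (hg.A t * Y s' * (hg.H t)ᵀ) i) +
      ∑ s, ∑ s', ∑ t : hg.T s s', ∑ i, Y s i ⬝ᵥ (hg.A t * Y s' * hg.H (hg.einv t)) i := by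
    rw [Pmat_mulVec_vecOf, vecOf_dotProduct, ← Finset.sum_add_distrib]
    refine Finset.sum_congr rfl fun s _ => ?_
    have h (i) : (∑ s', ∑ t : hg.T s s', hg.A t * Y s' * ((hg.H t)ᵀ + hg.H (hg.einv t))) i =
        ∑ s', ∑ t : hg.T s s', ((hg.A t * Y s' * (hg.H t)ᵀ) i +
          (hg.A t * Y s' * hg.H (hg.einv t)) i) := by
      ext; simp [Matrix.sum_apply, Matrix.mul_add]
    simp only [h, dotProduct_sum, dotProduct_add]
    rw [Finset.sum_comm, ← Finset.sum_add_distrib]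
    refine Finset.sum_congr rfl fun s' _ => ?_
    rw [Finset.sum_comm, ← Finset.sum_add_distrib]
    exact Finset.sum_congr rfl fun t _ => Finset.sum_add_distrib
  rw [hsplit]
  conv_lhs =>
    rhs
    rw [sum_edgeType_eq_sum_einv]
  simp only [← Finset.sum_add_distrib]
  refine Finset.sum_congr rfl fun s _ => Finset.sum_congr rfl fun s' _ =>
    Finset.sum_congr rfl fun t _ => ?_
  rw [sum_dotProduct_mul_mul, sum_dotProduct_mul_mul, hg.einv_einv,
    hg.A_einv]
  conv_lhs =>
    rhs
    rw [Finset.sum_comm]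
  simp only [← Finset.sum_add_distrib]
  refine Finset.sum_congr rfl fun i _ => Finset.sum_congr rfl fun j _ => ?_
  rw [transpose_apply, vecMul_transpose, dotProduct_mulVec, dotProduct_comm (Y s' j)]
  ring

theorem energy_eq_quadratic (lam : ℝ) (B Y : hg.Emb) :
    hg.energy lam B Y =
      1 / 2 * (hg.vecOf Y ⬝ᵥ hg.hessian lam *ᵥ hg.vecOf Y) - hg.vecOf B ⬝ᵥ hg.vecOf Y +
        1 / 2 * (hg.vecOf B ⬝ᵥ hg.vecOf B) := by
  have hfit : ∑ s, ∑ i, ∑ k, (Y s i k - B s i k) ^ 2 = hg.vecOf Y ⬝ᵥ hg.vecOf Y -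
      2 * (hg.vecOf B ⬝ᵥ hg.vecOf Y) + hg.vecOf B ⬝ᵥ hg.vecOf B := by
    rw [vecOf_dotProduct, vecOf_dotProduct, vecOf_dotProduct]
    simp only [dotProduct, Finset.mul_sum, ← Finset.sum_add_distrib, ← Finset.sum_sub_distrib]
    refine Finset.sum_congr rfl fun s _ => Finset.sum_congr rfl fun i _ =>
      Finset.sum_congr rfl fun k _ => ?_
    ring
  have hedge : ∑ s, ∑ s', ∑ t : hg.T s s', ∑ i, ∑ j,
      hg.A t i j * ∑ k', ((Y s i ᵥ* hg.H t) k' - Y s' j k') ^ 2 =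
        hg.vecOf Y ⬝ᵥ hg.Dblk *ᵥ hg.vecOf Y + (hg.vecOf Y ⬝ᵥ hg.Qmat *ᵥ hg.vecOf Y -
          hg.vecOf Y ⬝ᵥ hg.Pmat *ᵥ hg.vecOf Y) := by
    rw [dotProduct_Dblk_mulVec, dotProduct_Qmat_mulVec, dotProduct_Pmat_mulVec]
    simp only [← Finset.sum_add_distrib, ← Finset.sum_sub_distrib]
    refine Finset.sum_congr rfl fun s _ => Finset.sum_congr rfl fun s' _ =>
      Finset.sum_congr rfl fun t _ => Finset.sum_congr rfl fun i _ =>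
      Finset.sum_congr rfl fun j _ => ?_
    rw [← mul_sub, ← mul_add]
    simp only [dotProduct, Finset.mul_sum, ← Finset.sum_add_distrib, ← Finset.sum_sub_distrib]
    refine Finset.sum_congr rfl fun k _ => ?_
    ring
  rw [energy, Finset.sum_add_distrib, ← Finset.mul_sum, ← Finset.mul_sum, hfit, hedge, hessian]
  simp only [add_mulVec, sub_mulVec, one_mulVec, smul_mulVec, dotProduct_add, dotProduct_sub,
    dotProduct_smul, smul_eq_mul]
  ring

theorem dotProduct_self_le_hessian {lam : ℝ} (hlam : 0 ≤ lam) (v : hg.Idx → ℝ) :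
    v ⬝ᵥ v ≤ v ⬝ᵥ hg.hessian lam *ᵥ v := by
  obtain ⟨Y, rfl⟩ := hg.vecOf_surjective v
  have h := hg.energy_eq_quadratic lam 0 Y
  have h0 : hg.vecOf 0 = 0 := rfl
  rw [h0, zero_dotProduct, zero_dotProduct, energy, Finset.sum_add_distrib] at h
  have hfit : ∑ s, (1 / 2 : ℝ) * ∑ i, ∑ k, (Y s i k - (0 : hg.Emb) s i k) ^ 2 =
      1 / 2 * (hg.vecOf Y ⬝ᵥ hg.vecOf Y) := by
    rw [vecOf_dotProduct, ← Finset.mul_sum]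
    simp [dotProduct, sq]
  have hedge : 0 ≤ ∑ s, lam / 2 * ∑ s' : hg.S, ∑ t : hg.T s s', ∑ i, ∑ j,
      hg.A t i j * ∑ k', ((Y s i ᵥ* hg.H t) k' - Y s' j k') ^ 2 := by
    refine Finset.sum_nonneg fun s _ => mul_nonneg (by positivity) ?_
    refine Finset.sum_nonneg fun s' _ => Finset.sum_nonneg fun t _ => Finset.sum_nonneg fun i _ =>
      Finset.sum_nonneg fun j _ => mul_nonneg ?_ (by positivity)
    rcases hg.A_zero_one t i j with h | h <;> simp [h]
  linarith

theorem hessian_le {lam dmin σ : ℝ} (hlam : 0 < lam) (hd0 : 0 ≤ dmin)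
    (hdmin : ∀ x, dmin ≤ hg.Dblk x x) (hσ0 : 0 ≤ σ)
    (hσ : ∀ μ : ℝ, (∃ v : hg.Idx → ℝ, v ≠ 0 ∧ (hg.Qmat - hg.Pmat) *ᵥ v = μ • v) → μ ≤ σ)
    (v : hg.Idx → ℝ) :
    v ⬝ᵥ hg.hessian lam *ᵥ v ≤
      (1 + lam * (dmin + σ)) / (1 + lam * dmin) * ∑ x, (1 + lam * hg.Dblk x x) * v x ^ 2 := by
  have h := (hg.Qmat_isSymm.sub hg.Pmat_isSymm).dotProduct_mulVec_le hσ v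
  have hpos : 0 < 1 + lam * dmin := by positivity
  have hD : v ⬝ᵥ v + lam * (v ⬝ᵥ hg.Dblk *ᵥ v) = ∑ x, (1 + lam * hg.Dblk x x) * v x ^ 2 := by
    rw [Dblk_eq_diagonal]
    simp only [dotProduct, mulVec_diagonal, diagonal_apply_eq]
    rw [Finset.mul_sum, ← Finset.sum_add_distrib]
    exact Finset.sum_congr rfl fun x _ => by ring
  have hvv : (1 + lam * dmin) * (v ⬝ᵥ v) ≤ ∑ x, (1 + lam * hg.Dblk x x) * v x ^ 2 := by
    rw [dotProduct, Finset.mul_sum]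
    refine Finset.sum_le_sum fun x _ => ?_
    rw [← sq]
    gcongr
    exact hdmin x
  rw [hessian, add_mulVec, one_mulVec, smul_mulVec, add_mulVec, dotProduct_add, dotProduct_smul,
    dotProduct_add, smul_eq_mul, mul_add, ← add_assoc, hD, div_mul_eq_mul_div, le_div_iff₀ hpos]
  have h1 := mul_le_mul_of_nonneg_left h (mul_pos hlam hpos).le
  have h2 := mul_le_mul_of_nonneg_left hvv (mul_nonneg hlam.le hσ0)
  nlinarith

theorem precond_step_vecOf {lam : ℝ} (hlam : 0 ≤ lam) (α : ℝ) (B Y Y' : hg.Emb)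
    (h : ∀ s, Y' s = Y s - α • ((1 + lam • hg.Dtot s)⁻¹ * hg.energyGrad lam B Y s))
    (x : hg.Idx) :
    hg.vecOf Y' x = hg.vecOf Y x -
      α * ((1 + lam * hg.Dblk x x)⁻¹ * (hg.hessian lam *ᵥ hg.vecOf Y - hg.vecOf B) x) := by
  rw [← vecOf_energyGrad]
  obtain ⟨s, k, i⟩ := x
  have hinv : (1 + lam • hg.Dtot s)⁻¹ =
      diagonal fun i => (1 + lam * hg.Dblk ⟨s, k, i⟩ ⟨s, k, i⟩)⁻¹ := by
    apply inv_eq_left_inv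
    rw [Dtot_eq_diagonal, ← diagonal_one, ← diagonal_smul, diagonal_add, diagonal_mul_diagonal]
    congr 1
    ext i
    have := mul_nonneg hlam (hg.Dblk_apply_self_nonneg ⟨s, k, i⟩)
    rw [Dblk_eq_diagonal, diagonal_apply_eq] at this ⊢
    exact inv_mul_cancel₀ (by simp only at this; positivity)
  simp only [vecOf, h, hinv, Matrix.sub_apply, Matrix.smul_apply, diagonal_mul, smul_eq_mul]

end HeteroSetup

/-- **Theorem 3.2.**  In the heterogeneous setup with λ > 0, let `d_min` be
the minimum diagonal entry of `D_blk` and `σ_max ≥ 0` the largest eigenvalue of the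
symmetric matrix `Q − P`.  Let `Y⁽ᵏ⁾` be the preconditioned gradient iterates
`Y_s⁽ᵏ⁺¹⁾ = Y_s⁽ᵏ⁾ − α (I + λ D_s)⁻¹ ∇_{Y_s} ℓ(Y⁽ᵏ⁾)` from any initialization.  If
`0 < α < (2 + 2λ d_min) / (1 + λ (d_min + σ_max))`, then the iterates monotonically
decrease the energy, and `Y⁽ᵏ⁾` converges to the unique global minimizer of ℓ. -/
theorem stmt4 (hg : HeteroSetup) (lam : ℝ) (hlam : 0 < lam) (B : hg.Emb)
    (dmin : ℝ) (hdmin : IsLeast (Set.range fun x : hg.Idx => hg.Dblk x x) dmin)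
    (σmax : ℝ) (hσ0 : 0 ≤ σmax)
    (hσ : IsGreatest
      {μ : ℝ | ∃ v : hg.Idx → ℝ, v ≠ 0 ∧ (hg.Qmat - hg.Pmat) *ᵥ v = μ • v} σmax)
    (α : ℝ) (hα0 : 0 < α)
    (hα : α < (2 + 2 * lam * dmin) / (1 + lam * (dmin + σmax)))
    (Y : ℕ → hg.Emb)
    (hrec : ∀ k (s : hg.S),
      Y (k + 1) s = Y k s - α • ((1 + lam • hg.Dtot s)⁻¹ * hg.energyGrad lam B (Y k) s)) :
    (∀ k, hg.energy lam B (Y (k + 1)) ≤ hg.energy lam B (Y k)) ∧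
    (∃ Ystar : hg.Emb,
      (∀ Z : hg.Emb, hg.energy lam B Ystar ≤ hg.energy lam B Z) ∧
      (∀ Z : hg.Emb, (∀ W : hg.Emb, hg.energy lam B Z ≤ hg.energy lam B W) → Z = Ystar) ∧
      Tendsto Y atTop (nhds Ystar)) := by
  have hd0 : 0 ≤ dmin := by
    obtain ⟨x, rfl⟩ := hdmin.1
    exact hg.Dblk_apply_self_nonneg x
  have hd : ∀ x, dmin ≤ hg.Dblk x x := fun x => hdmin.2 ⟨x, rfl⟩
  have hm : ∀ x, 1 ≤ 1 + lam * hg.Dblk x x := fun x =>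
    le_add_of_nonneg_right (mul_nonneg hlam.le (hg.Dblk_apply_self_nonneg x))
  have hK := hg.hessian_isSymm lam
  have hL := hg.hessian_le hlam hd0 hd hσ0 fun μ hμ => hσ.2 hμ
  have hαL : α * ((1 + lam * (dmin + σmax)) / (1 + lam * dmin)) < 2 := by
    rw [lt_div_iff₀ (by positivity)] at hα
    rw [← mul_div_assoc, div_lt_iff₀ (by positivity)]
    linarith
  have hx := fun k => hg.precond_step_vecOf hlam.le α B (Y k) (Y (k + 1)) (hrec k)
  constructor
  · intro k
    have h := quadratic_precond_step_le hK (hg.vecOf B) hm hL hα0 hαL (fun _ => rfl)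
      (funext (hx k))
    rw [energy_eq_quadratic, energy_eq_quadratic]
    refine add_le_add_left ((le_add_of_nonneg_right (mul_nonneg ?_ ?_)).trans h) _
    · exact mul_nonneg hα0.le (by linarith)
    · exact Finset.sum_nonneg fun _ _ => mul_self_nonneg _
  · obtain ⟨c, hc, hlim⟩ := quadratic_precond_descent hK (hg.dotProduct_self_le_hessian hlam.le)
      (hg.vecOf B) hm hL hα0 hαL (x := fun k => hg.vecOf (Y k)) hx
    obtain ⟨Ystar, rfl⟩ := hg.vecOf_surjective c
    have hgap : ∀ Z, hg.energy lam B Ystar +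
        1 / 2 * ((hg.vecOf Z - hg.vecOf Ystar) ⬝ᵥ (hg.vecOf Z - hg.vecOf Ystar)) ≤
          hg.energy lam B Z := by
      intro Z
      have h := hg.dotProduct_self_le_hessian hlam.le (hg.vecOf Z - hg.vecOf Ystar)
      rw [energy_eq_quadratic, energy_eq_quadratic, hc (hg.vecOf Z)]
      linarith
    have hsq : ∀ v : hg.Idx → ℝ, 0 ≤ v ⬝ᵥ v := fun v =>
      Finset.sum_nonneg fun _ _ => mul_self_nonneg _
    refine ⟨Ystar, fun Z => ?_, fun Z hZ => ?_, ?_⟩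
    · linarith [hgap Z, hsq (hg.vecOf Z - hg.vecOf Ystar)]
    · have h0 : hg.vecOf Z - hg.vecOf Ystar = 0 := dotProduct_self_eq_zero.1 <|
        le_antisymm (by linarith [hgap Z, hZ Ystar]) (hsq _)
      ext s i k
      exact congrFun (sub_eq_zero.1 h0) ⟨s, (k, i)⟩
    · refine tendsto_pi_nhds.2 fun s => tendsto_pi_nhds.2 fun i => tendsto_pi_nhds.2 fun k => ?_
      exact tendsto_pi_nhds.1 hlim ⟨s, (k, i)⟩
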